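/- For two information structures θ and θ' with binary state and two conditionally independent signals, with priors μ and μ' and report distributions P_θ and P_{θ'}, the difference of priors is bounded by both distances between the report distributions: |μ − μ'| ≤ d_TV(P_θ, P_{θ'}) and |μ − μ'| ≤ d_EM(P_θ, P_{θ'}). -/

import Mathlib

open Finset

/-- An information structure with a binary state `ω : Bool` (prior `μ = P(ω = 1)`) and two
signals `s1 : S1`, `s2 : S2` that are conditionally independent given the state,
encoded by the joint mass function `P`. -/
structure InfoStruct (S1 S2 : Type) [Fintype S1] [Fintype S2] : Type where
  P : Bool → S1 → S2 → ℝ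
  nonneg : ∀ ω s1 s2, 0 ≤ P ω s1 s2
  sum_one : ∑ ω : Bool, ∑ s1 : S1, ∑ s2 : S2, P ω s1 s2 = 1
  condIndep : ∀ ω s1 s2,
    (∑ t1 : S1, ∑ t2 : S2, P ω t1 t2) * P ω s1 s2 =
      (∑ t2 : S2, P ω s1 t2) * (∑ t1 : S1, P ω t1 s2)

namespace InfoStruct

variable {S1 S2 : Type} [Fintype S1] [Fintype S2]

/-- The prior `μ = P(ω = 1)`. -/
def prior (θ : InfoStruct S1 S2) : ℝ := ∑ s1 : S1, ∑ s2 : S2, θ.P true s1 s2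

/-- The marginal probability of a signal pair `(s1, s2)`. -/
def pSig (θ : InfoStruct S1 S2) (s1 : S1) (s2 : S2) : ℝ := ∑ ω : Bool, θ.P ω s1 s2

/-- The marginal probability of agent 1's signal. -/
def p1 (θ : InfoStruct S1 S2) (s1 : S1) : ℝ := ∑ ω : Bool, ∑ s2 : S2, θ.P ω s1 s2

/-- The marginal probability of agent 2's signal. -/
def p2 (θ : InfoStruct S1 S2) (s2 : S2) : ℝ := ∑ ω : Bool, ∑ s1 : S1, θ.P ω s1 s2

/-- Agent 1's report `x1 = P(ω = 1 | s1)`. -/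
noncomputable def x1 (θ : InfoStruct S1 S2) (s1 : S1) : ℝ :=
  (∑ s2 : S2, θ.P true s1 s2) / θ.p1 s1

/-- Agent 2's report `x2 = P(ω = 1 | s2)`. -/
noncomputable def x2 (θ : InfoStruct S1 S2) (s2 : S2) : ℝ :=
  (∑ s1 : S1, θ.P true s1 s2) / θ.p2 s2

/-- The posterior `P(ω = 1 | s1, s2)`. -/
noncomputable def post (θ : InfoStruct S1 S2) (s1 : S1) (s2 : S2) : ℝ :=
  θ.P true s1 s2 / θ.pSig s1 s2

/-- Expectation of a function of the report pair `(x1, x2)` under `θ`. -/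
noncomputable def expect (θ : InfoStruct S1 S2) (h : ℝ → ℝ → ℝ) : ℝ :=
  ∑ s1 : S1, ∑ s2 : S2, θ.pSig s1 s2 * h (θ.x1 s1) (θ.x2 s2)

/-- Probability that the report pair `(x1, x2)` lies in a set `A ⊆ ℝ²`. -/
noncomputable def probR (θ : InfoStruct S1 S2) (A : Set (ℝ × ℝ)) : ℝ :=
  ∑ s1 : S1, ∑ s2 : S2, A.indicator (fun _ => θ.pSig s1 s2) (θ.x1 s1, θ.x2 s2)

end InfoStruct

/-- Total variation distance between the report distributions of two information
structures: `d_TV(P,Q) = (1/2) ⨆_{‖h‖_∞ ≤ 1} (E_P[h] - E_Q[h])`. -/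
noncomputable def dTV {S1 S2 T1 T2 : Type} [Fintype S1] [Fintype S2] [Fintype T1] [Fintype T2]
    (θ : InfoStruct S1 S2) (θ' : InfoStruct T1 T2) : ℝ :=
  sSup {r : ℝ | ∃ h : ℝ → ℝ → ℝ, (∀ a b, |h a b| ≤ 1) ∧
    r = (θ.expect h - θ'.expect h) / 2}

/-- Earth mover's (Wasserstein-1) distance, w.r.t. the ℓ1 metric, between the report
distributions of two information structures:
`d_EM(P,Q) = ⨆_{‖h‖_Lip ≤ 1} (E_P[h] - E_Q[h])`. -/
noncomputable def dEM {S1 S2 T1 T2 : Type} [Fintype S1] [Fintype S2] [Fintype T1] [Fintype T2]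
    (θ : InfoStruct S1 S2) (θ' : InfoStruct T1 T2) : ℝ :=
  sSup {r : ℝ | ∃ h : ℝ → ℝ → ℝ,
    (∀ a b a' b', |h a b - h a' b'| ≤ |a - a'| + |b - b'|) ∧
    r = θ.expect h - θ'.expect h}

namespace InfoStruct

variable {S1 S2 : Type} [Fintype S1] [Fintype S2]

theorem pSig_nonneg (θ : InfoStruct S1 S2) (s1 : S1) (s2 : S2) : 0 ≤ θ.pSig s1 s2 :=
  Finset.sum_nonneg fun ω _ => θ.nonneg ω s1 s2

theorem sum_pSig_right (θ : InfoStruct S1 S2) (s1 : S1) : ∑ s2 : S2, θ.pSig s1 s2 = θ.p1 s1 :=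
  Finset.sum_comm

theorem sum_p1 (θ : InfoStruct S1 S2) : ∑ s1 : S1, θ.p1 s1 = 1 :=
  Finset.sum_comm.trans θ.sum_one

theorem sum_true_right_nonneg (θ : InfoStruct S1 S2) (s1 : S1) : 0 ≤ ∑ s2 : S2, θ.P true s1 s2 :=
  Finset.sum_nonneg fun _ _ => θ.nonneg _ _ _

theorem sum_true_left_nonneg (θ : InfoStruct S1 S2) (s2 : S2) : 0 ≤ ∑ s1 : S1, θ.P true s1 s2 :=
  Finset.sum_nonneg fun _ _ => θ.nonneg _ _ _

theorem sum_true_right_le_p1 (θ : InfoStruct S1 S2) (s1 : S1) :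
    ∑ s2 : S2, θ.P true s1 s2 ≤ θ.p1 s1 :=
  Finset.single_le_sum (f := fun ω => ∑ s2 : S2, θ.P ω s1 s2)
    (fun _ _ => Finset.sum_nonneg fun _ _ => θ.nonneg _ _ _) (Finset.mem_univ true)

theorem sum_true_left_le_p2 (θ : InfoStruct S1 S2) (s2 : S2) :
    ∑ s1 : S1, θ.P true s1 s2 ≤ θ.p2 s2 :=
  Finset.single_le_sum (f := fun ω => ∑ s1 : S1, θ.P ω s1 s2)
    (fun _ _ => Finset.sum_nonneg fun _ _ => θ.nonneg _ _ _) (Finset.mem_univ true)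

theorem x1_mem_Icc (θ : InfoStruct S1 S2) (s1 : S1) : θ.x1 s1 ∈ Set.Icc (0 : ℝ) 1 := by
  have h0 := θ.sum_true_right_nonneg s1
  have h1 := θ.sum_true_right_le_p1 s1
  exact ⟨div_nonneg h0 (h0.trans h1), div_le_one_of_le₀ h1 (h0.trans h1)⟩

theorem x2_mem_Icc (θ : InfoStruct S1 S2) (s2 : S2) : θ.x2 s2 ∈ Set.Icc (0 : ℝ) 1 := by
  have h0 := θ.sum_true_left_nonneg s2
  have h1 := θ.sum_true_left_le_p2 s2
  exact ⟨div_nonneg h0 (h0.trans h1), div_le_one_of_le₀ h1 (h0.trans h1)⟩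

theorem p1_mul_x1 (θ : InfoStruct S1 S2) (s1 : S1) :
    θ.p1 s1 * θ.x1 s1 = ∑ s2 : S2, θ.P true s1 s2 := by
  have h0 := θ.sum_true_right_nonneg s1
  have h1 := θ.sum_true_right_le_p1 s1
  rw [mul_comm]
  exact div_mul_cancel_of_imp fun h => le_antisymm (h ▸ h1) h0

/-- Expectation is monotone, reports lying in the unit square. -/
theorem expect_mono (θ : InfoStruct S1 S2) {f g : ℝ → ℝ → ℝ}
    (h : ∀ a ∈ Set.Icc (0 : ℝ) 1, ∀ b ∈ Set.Icc (0 : ℝ) 1, f a b ≤ g a b) :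
    θ.expect f ≤ θ.expect g :=
  Finset.sum_le_sum fun s1 _ => Finset.sum_le_sum fun s2 _ =>
    mul_le_mul_of_nonneg_left (h _ (θ.x1_mem_Icc s1) _ (θ.x2_mem_Icc s2)) (θ.pSig_nonneg s1 s2)

theorem expect_congr (θ : InfoStruct S1 S2) {f g : ℝ → ℝ → ℝ}
    (h : ∀ a ∈ Set.Icc (0 : ℝ) 1, ∀ b ∈ Set.Icc (0 : ℝ) 1, f a b = g a b) :
    θ.expect f = θ.expect g :=
  le_antisymm (θ.expect_mono fun a ha b hb => (h a ha b hb).le)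
    (θ.expect_mono fun a ha b hb => (h a ha b hb).ge)

/-- An affine function of the first report averages to the same function of the prior. -/
theorem expect_affine (θ : InfoStruct S1 S2) (c d : ℝ) :
    θ.expect (fun a _ => c * a + d) = c * θ.prior + d := by
  have h (s1 : S1) : ∑ s2 : S2, θ.pSig s1 s2 * (c * θ.x1 s1 + d) =
      c * ∑ s2 : S2, θ.P true s1 s2 + d * θ.p1 s1 := by
    rw [← Finset.sum_mul, sum_pSig_right, ← p1_mul_x1]
    ring
  simp only [expect, h, Finset.sum_add_distrib, ← Finset.mul_sum, sum_p1, mul_one, prior]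

theorem expect_const (θ : InfoStruct S1 S2) (d : ℝ) : θ.expect (fun _ _ => d) = d := by
  simpa using θ.expect_affine 0 d

end InfoStruct

section Distances

variable {S1 S2 T1 T2 : Type} [Fintype S1] [Fintype S2] [Fintype T1] [Fintype T2]

theorem le_dTV (θ : InfoStruct S1 S2) (θ' : InfoStruct T1 T2) {h : ℝ → ℝ → ℝ}
    (hh : ∀ a b, |h a b| ≤ 1) : (θ.expect h - θ'.expect h) / 2 ≤ dTV θ θ' := by
  refine le_csSup ⟨1, ?_⟩ ⟨h, hh, rfl⟩
  rintro _ ⟨g, hg, rfl⟩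
  have h1 := θ.expect_mono fun a _ b _ => (abs_le.1 (hg a b)).2
  have h2 := θ'.expect_mono fun a _ b _ => (abs_le.1 (hg a b)).1
  rw [InfoStruct.expect_const] at h1 h2
  linarith

theorem le_dEM (θ : InfoStruct S1 S2) (θ' : InfoStruct T1 T2) {h : ℝ → ℝ → ℝ}
    (hh : ∀ a b a' b', |h a b - h a' b'| ≤ |a - a'| + |b - b'|) :
    θ.expect h - θ'.expect h ≤ dEM θ θ' := by
  refine le_csSup ⟨4, ?_⟩ ⟨h, hh, rfl⟩
  rintro _ ⟨g, hg, rfl⟩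
  have bound : ∀ a ∈ Set.Icc (0 : ℝ) 1, ∀ b ∈ Set.Icc (0 : ℝ) 1,
      g 0 0 - 2 ≤ g a b ∧ g a b ≤ g 0 0 + 2 := by
    intro a ha b hb
    have h := hg a b 0 0
    rw [sub_zero, sub_zero, abs_of_nonneg ha.1, abs_of_nonneg hb.1, abs_le] at h
    constructor <;> linarith [ha.2, hb.2]
  have h1 := θ.expect_mono fun a ha b hb => (bound a ha b hb).2
  have h2 := θ'.expect_mono fun a ha b hb => (bound a ha b hb).1
  rw [InfoStruct.expect_const] at h1 h2
  linarith

theorem mul_prior_sub_le_dTV (θ : InfoStruct S1 S2) (θ' : InfoStruct T1 T2) {c : ℝ}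
    (hc : |c| ≤ 1) : c * (θ.prior - θ'.prior) ≤ dTV θ θ' := by
  have key := le_dTV θ θ' (h := fun a _ => c * (2 * max 0 (min 1 a) - 1)) fun a _ => by
    rw [abs_mul]
    refine mul_le_one₀ hc (abs_nonneg _) (abs_le.2 ⟨?_, ?_⟩)
    · linarith [le_max_left 0 (min 1 a)]
    · linarith [max_le zero_le_one (min_le_left 1 a)]
  have clamp : ∀ a ∈ Set.Icc (0 : ℝ) 1, ∀ b ∈ Set.Icc (0 : ℝ) 1,
      c * (2 * max 0 (min 1 a) - 1) = 2 * c * a + -c := by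
    intro a ha _ _
    rw [min_eq_right ha.2, max_eq_right ha.1]
    ring
  rw [θ.expect_congr clamp, θ'.expect_congr clamp, InfoStruct.expect_affine,
    InfoStruct.expect_affine] at key
  linarith

theorem mul_prior_sub_le_dEM (θ : InfoStruct S1 S2) (θ' : InfoStruct T1 T2) {c : ℝ}
    (hc : |c| ≤ 1) : c * (θ.prior - θ'.prior) ≤ dEM θ θ' := by
  have key := le_dEM θ θ' (h := fun a _ => c * a + 0) fun a b a' b' => by
    rw [add_zero, add_zero, ← mul_sub, abs_mul]
    exact (mul_le_of_le_one_left (abs_nonneg _) hc).trans (le_add_of_nonneg_right (abs_nonneg _))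
  rw [InfoStruct.expect_affine, InfoStruct.expect_affine] at key
  linarith

end Distances

/-- Prior difference bounded by distances of report distributions:
for two conditionally independent information structures, `|μ - μ'|` is at most both the
total variation distance and the earth mover's distance between the report distributions. -/
theorem prior_diff_le_dists {S1 S2 T1 T2 : Type}
    [Fintype S1] [Fintype S2] [Fintype T1] [Fintype T2]
    (θ : InfoStruct S1 S2) (θ' : InfoStruct T1 T2) :
    |θ.prior - θ'.prior| ≤ dTV θ θ' ∧ |θ.prior - θ'.prior| ≤ dEM θ θ' := by
  have h1 : |(1 : ℝ)| ≤ 1 := by simp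
  have h2 : |(-1 : ℝ)| ≤ 1 := by simp
  refine ⟨abs_le'.2 ⟨?_, ?_⟩, abs_le'.2 ⟨?_, ?_⟩⟩
  · linarith [mul_prior_sub_le_dTV θ θ' h1]
  · linarith [mul_prior_sub_le_dTV θ θ' h2]
  · linarith [mul_prior_sub_le_dEM θ θ' h1]
  · linarith [mul_prior_sub_le_dEM θ θ' h2]
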